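/- arXiv:2402.05575 — 6 statements merged into one kernel-verified Lean document; each statement's English description precedes it below -/
import Mathlib

section
/- Let m ≥ 1 and let β : Fin m → ℝ satisfy 0 < β_g ≤ 1/m for every group g and Σ_g β_g < 1. Let (g_t)_{t≥1} be any sequence of groups in Fin m, let N_{g,t} := #{s : 1 ≤ s ≤ t, g_s = g} and define the deficit D(g,t) := β_g · t − N_{g,t}. Suppose the sequence follows the max-deficit rule: for every t ≥ 0, if there exists h with D(h,t) > 0, then the group g_{t+1} selected at round t+1 satisfies D(g_{t+1}, t) ≥ D(h,t) for all h ∈ Fin m. Then for every t ≥ 1 and every group g, N_{g,t} ≥ ⌊β_g · t⌋; i.e., the process satisfies anytime Group Exposure Fairness. -/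
/-- The deficit of group `g` after `t` rounds: its entitlement `β g * t` minus the number of
rounds in which it was selected. -/
noncomputable def exposureDeficit {m : ℕ} (β : Fin m → ℝ) (gs : ℕ → Fin m) (t : ℕ)
    (g : Fin m) : ℝ :=
  β g * t - (((Finset.range t).filter (fun s => gs s = g)).card : ℝ)

theorem exposureDeficit_succ {m : ℕ} (β : Fin m → ℝ) (gs : ℕ → Fin m) (t : ℕ) (g : Fin m) :
    exposureDeficit β gs (t + 1) g
      = exposureDeficit β gs t g + β g - if gs t = g then 1 else 0 := by
  unfold exposureDeficit
  rw [Finset.range_add_one, Finset.filter_insert]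
  split_ifs with h
  · rw [Finset.card_insert_of_notMem (by simp)]
    push_cast
    ring
  · push_cast
    ring

theorem sum_exposureDeficit_succ {m : ℕ} (β : Fin m → ℝ) (gs : ℕ → Fin m) (t : ℕ)
    (S : Finset (Fin m)) :
    ∑ g ∈ S, exposureDeficit β gs (t + 1) g
      = ∑ g ∈ S, exposureDeficit β gs t g + ∑ g ∈ S, β g - if gs t ∈ S then 1 else 0 := by
  simp only [exposureDeficit_succ, Finset.sum_sub_distrib, Finset.sum_add_distrib,
    Finset.sum_ite_eq]

/-- Under the max-deficit rule with all rates at most `1 / m`, the total deficit of any `k` groups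
never exceeds `k * (m - k) / m`. -/
theorem mul_sum_exposureDeficit_le {m : ℕ} (β : Fin m → ℝ) (gs : ℕ → Fin m)
    (hβle : ∀ g, m * β g ≤ 1)
    (hrule : ∀ t, (∃ h, 0 < exposureDeficit β gs t h) →
      ∀ h, exposureDeficit β gs t h ≤ exposureDeficit β gs t (gs t))
    (t : ℕ) (S : Finset (Fin m)) :
    m * ∑ g ∈ S, exposureDeficit β gs t g ≤ S.card * (m - S.card) := by
  have card_le (S : Finset (Fin m)) : (S.card : ℝ) ≤ m := by
    exact_mod_cast (Finset.card_le_univ S).trans_eq (Fintype.card_fin m)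
  induction t generalizing S with
  | zero =>
    simpa [exposureDeficit] using
      mul_nonneg (Nat.cast_nonneg S.card) (sub_nonneg.2 (card_le S))
  | succ t ih =>
    have hβS : m * ∑ g ∈ S, β g ≤ S.card := by
      rw [Finset.mul_sum]
      simpa using Finset.sum_le_card_nsmul S _ 1 fun g _ => hβle g
    have hk : (0 : ℝ) ≤ S.card := Nat.cast_nonneg _
    rw [sum_exposureDeficit_succ]
    split_ifs with hS
    · linarith [ih S, card_le S]
    · have hcard := Finset.card_insert_of_notMem hS
      by_cases hpos : ∃ h, 0 < exposureDeficit β gs t h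
      · have hmax : ∑ g ∈ S, exposureDeficit β gs t g
            ≤ S.card * exposureDeficit β gs t (gs t) := by
          simpa using Finset.sum_le_card_nsmul S _ _ fun g _ => hrule t hpos g
        have hins := ih (insert (gs t) S)
        rw [Finset.sum_insert hS, hcard] at hins
        push_cast at hins
        have hm0 : (0 : ℝ) ≤ m := Nat.cast_nonneg _
        have hbound : m * ∑ g ∈ S, exposureDeficit β gs t g
            ≤ S.card * (m - (S.card + 1)) := by
          refine le_of_mul_le_mul_left ?_ (by positivity : (0 : ℝ) < S.card + 1)
          linarith [mul_le_mul_of_nonneg_left hmax hm0, mul_le_mul_of_nonneg_left hins hk]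
        linarith
      · push Not at hpos
        have hsum : m * ∑ g ∈ S, exposureDeficit β gs t g ≤ 0 :=
          mul_nonpos_of_nonneg_of_nonpos (Nat.cast_nonneg _)
            (Finset.sum_nonpos fun g _ => hpos g)
        have hlt := card_le (insert (gs t) S)
        rw [hcard] at hlt
        push_cast at hlt
        nlinarith

/-- Anytime Group Exposure Fairness of the max-deficit selection rule:
if whenever some group has positive deficit `β h * t - N h t`, the group
selected at round `t+1` (namely `gs t`) has maximal deficit, then at every
time `t ≥ 1` each group `g` has been selected at least `⌊β g * t⌋` times.
Here `gs s` is the group selected at round `s + 1`, so the count of group `g`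
among the first `t` rounds is the number of `s ∈ range t` with `gs s = g`. -/
theorem group_exposure_fairness_anytime
    (m : ℕ) (hm : 1 ≤ m) (β : Fin m → ℝ)
    (hβpos : ∀ g, 0 < β g) (hβle : ∀ g, β g ≤ 1 / (m : ℝ))
    (hβsum : ∑ g, β g < 1)
    (gs : ℕ → Fin m)
    (hrule : ∀ t : ℕ,
      (∃ h : Fin m,
        0 < β h * t - (((Finset.range t).filter (fun s => gs s = h)).card : ℝ)) →
      ∀ h : Fin m,
        β h * t - (((Finset.range t).filter (fun s => gs s = h)).card : ℝ)
          ≤ β (gs t) * t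
              - (((Finset.range t).filter (fun s => gs s = gs t)).card : ℝ)) :
    ∀ t : ℕ, 1 ≤ t → ∀ g : Fin m,
      (⌊β g * t⌋ : ℝ) ≤ (((Finset.range t).filter (fun s => gs s = g)).card : ℝ) := by
  have hm0 : (0 : ℝ) < m := by exact_mod_cast hm
  intro t _ g
  have hdef := mul_sum_exposureDeficit_le β gs
    (fun g => by simpa [hm0.ne'] using mul_le_mul_of_nonneg_left (hβle g) hm0.le) hrule t {g}
  rw [Finset.sum_singleton, Finset.card_singleton, Nat.cast_one, one_mul] at hdef
  have hlt : exposureDeficit β gs t g < 1 := by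
    by_contra! h
    linarith [mul_le_mul_of_nonneg_left h hm0.le]
  unfold exposureDeficit at hlt
  have hfloor : ⌊β g * t⌋ < (((Finset.range t).filter (fun s => gs s = g)).card : ℤ) + 1 := by
    rw [Int.floor_lt]
    push_cast
    linarith
  exact_mod_cast Int.lt_add_one_iff.1 hfloor
end

section
/- Let m ≥ 1 and let β : Fin m → ℝ satisfy 0 < β_g ≤ 1/m for every group g and Σ_g β_g < 1. Let (g_t)_{t≥1} be a sequence of groups in Fin m following the max-deficit rule (for every t ≥ 0, if some group h has deficit D(h,t) := β_h · t − N_{h,t} > 0, then D(g_{t+1}, t) ≥ D(h,t) for all h), where N_{g,t} := #{s : 1 ≤ s ≤ t, g_s = g}. Then for every t ≥ 1: (1) D(g,t) < 1 for every group g; and (2) for every j ∈ {1,…,m}, the number of groups g with D(g,t) ≥ (m−j)/m is at most j. -/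
/-- A process `D` on `m` groups starting at `0`, in which each round raises every group by at most
`1 / m` and lowers a group of maximal value by `1` whenever some value is positive, never has more
than `j` groups with value at least `(m - j) / m`, for `j < m`. -/
lemma card_filter_deficit_le {m : ℕ} {β : Fin m → ℝ} (hβ : ∀ g, β g ≤ 1 / (m : ℝ))
    {gs : ℕ → Fin m} {D : ℕ → Fin m → ℝ} (hzero : ∀ g, D 0 g = 0)
    (hsucc : ∀ t g, D (t + 1) g = D t g + β g - if gs t = g then 1 else 0)
    (hrule : ∀ t, (∃ h, 0 < D t h) → ∀ h, D t h ≤ D t (gs t)) (t : ℕ) :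
    ∀ j < m, (Finset.univ.filter fun g => ((m : ℝ) - j) / m ≤ D t g).card ≤ j := by
  induction t with
  | zero =>
    intro j hj
    have hjm : (j : ℝ) < m := by exact_mod_cast hj
    have hpos : 0 < ((m : ℝ) - j) / m :=
      div_pos (by linarith) (lt_of_le_of_lt (Nat.cast_nonneg j) hjm)
    simp [hzero, not_le.mpr hpos]
  | succ t ih =>
    intro j hj
    have hm : (0 : ℝ) < m := by exact_mod_cast Nat.zero_lt_of_lt hj
    have hlt_one : ∀ g, D t g < 1 := by
      intro g
      have hcard := ih 0 (Nat.zero_lt_of_lt hj)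
      rw [Nat.le_zero, Finset.card_eq_zero, Finset.filter_eq_empty_iff] at hcard
      simpa [hm.ne'] using hcard (Finset.mem_univ g)
    have hsel : D (t + 1) (gs t) < ((m : ℝ) - j) / m := by
      have hle : 1 / (m : ℝ) ≤ ((m : ℝ) - j) / m := by
        have : (j : ℝ) + 1 ≤ m := by exact_mod_cast hj
        gcongr
        linarith
      have := hsucc t (gs t)
      rw [if_pos rfl] at this
      linarith [hlt_one (gs t), hβ (gs t)]
    have hstep : ∀ g, ((m : ℝ) - j) / m ≤ D (t + 1) g →
        g ≠ gs t ∧ ((m : ℝ) - (j + 1 : ℕ)) / m ≤ D t g := by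
      intro g hg
      have hne : g ≠ gs t := by
        rintro rfl
        exact absurd hg (not_le.mpr hsel)
      refine ⟨hne, ?_⟩
      have hD := hsucc t g
      rw [if_neg hne.symm] at hD
      have hsplit : ((m : ℝ) - (j + 1 : ℕ)) / m = ((m : ℝ) - j) / m - 1 / m := by
        push_cast
        ring
      linarith [hβ g]
    obtain hjm | hjm : j + 1 = m ∨ j + 1 < m := by omega
    · have hsub : (Finset.univ.filter fun g => ((m : ℝ) - j) / m ≤ D (t + 1) g) ⊆
          Finset.univ.erase (gs t) := fun g hg =>
        Finset.mem_erase.mpr ⟨(hstep g (Finset.mem_filter.mp hg).2).1, Finset.mem_univ g⟩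
      have hcard := Finset.card_le_card hsub
      rw [Finset.card_erase_of_mem (Finset.mem_univ _), Finset.card_fin] at hcard
      omega
    · obtain hempty | ⟨h, hh⟩ :=
        (Finset.univ.filter fun g => ((m : ℝ) - j) / m ≤ D (t + 1) g).eq_empty_or_nonempty
      · simp [hempty]
      have hhD := (hstep h (Finset.mem_filter.mp hh).2).2
      have hpos : 0 < ((m : ℝ) - (j + 1 : ℕ)) / m :=
        div_pos (sub_pos.mpr (by exact_mod_cast hjm)) hm
      have hmem : gs t ∈ Finset.univ.filter fun g => ((m : ℝ) - (j + 1 : ℕ)) / m ≤ D t g :=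
        Finset.mem_filter.mpr
          ⟨Finset.mem_univ _, hhD.trans (hrule t ⟨h, hpos.trans_le hhD⟩ h)⟩
      have hsub : (Finset.univ.filter fun g => ((m : ℝ) - j) / m ≤ D (t + 1) g) ⊆
          (Finset.univ.filter fun g => ((m : ℝ) - (j + 1 : ℕ)) / m ≤ D t g).erase (gs t) := by
        intro g hg
        obtain ⟨hne, hle⟩ := hstep g (Finset.mem_filter.mp hg).2
        exact Finset.mem_erase.mpr ⟨hne, Finset.mem_filter.mpr ⟨Finset.mem_univ g, hle⟩⟩
      have hcard := Finset.card_le_card hsub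
      rw [Finset.card_erase_of_mem hmem] at hcard
      have := ih (j + 1) hjm
      omega

/-- Fairness Lemma for the max-deficit selection rule: at every time `t ≥ 1`,
(1) every group's deficit `β g * t - N g t` is strictly less than 1, and
(2) for every `j ∈ {1,…,m}`, at most `j` groups have deficit at least
`(m - j)/m`.  Here `gs s` is the group selected at round `s + 1`, so
`N g t = #{s ∈ range t | gs s = g}`. -/
theorem fairness_lemma_max_deficit
    (m : ℕ) (hm : 1 ≤ m) (β : Fin m → ℝ)
    (hβpos : ∀ g, 0 < β g) (hβle : ∀ g, β g ≤ 1 / (m : ℝ))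
    (hβsum : ∑ g, β g < 1)
    (gs : ℕ → Fin m)
    (hrule : ∀ t : ℕ,
      (∃ h : Fin m,
        0 < β h * t - (((Finset.range t).filter (fun s => gs s = h)).card : ℝ)) →
      ∀ h : Fin m,
        β h * t - (((Finset.range t).filter (fun s => gs s = h)).card : ℝ)
          ≤ β (gs t) * t
              - (((Finset.range t).filter (fun s => gs s = gs t)).card : ℝ)) :
    ∀ t : ℕ, 1 ≤ t →
      (∀ g : Fin m,
        β g * t - (((Finset.range t).filter (fun s => gs s = g)).card : ℝ) < 1)
      ∧ (∀ j : ℕ, 1 ≤ j → j ≤ m →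
          Set.ncard {g : Fin m |
              ((m : ℝ) - j) / m
                ≤ β g * t - (((Finset.range t).filter (fun s => gs s = g)).card : ℝ)}
            ≤ j) := by
  intro t _
  have key := card_filter_deficit_le hβle (gs := gs)
    (D := fun t g => β g * t - (((Finset.range t).filter (fun s => gs s = g)).card : ℝ))
    (by simp)
    (by
      intro t g
      simp only [Finset.range_add_one, Finset.filter_insert]
      split_ifs
      · rw [Finset.card_insert_of_notMem (by simp)]
        push_cast
        ring
      · push_cast
        ring)
    hrule t
  have hm0 : (m : ℝ) ≠ 0 := by exact_mod_cast (by omega : m ≠ 0)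
  refine ⟨fun g => ?_, fun j _ hjm => ?_⟩
  · have hcard := key 0 hm
    rw [Nat.le_zero, Finset.card_eq_zero, Finset.filter_eq_empty_iff] at hcard
    simpa [hm0] using hcard (Finset.mem_univ g)
  · obtain rfl | hlt := hjm.eq_or_lt
    · exact (Set.ncard_le_card _).trans (by simp)
    · simpa [← Set.ncard_coe_finset] using key j hlt
end

section
/- Let k ≥ 1, let L > 0, let 0 < γ₁ ≤ γ₂, and let f : ℝ → ℝ be L-Lipschitz with γ₁ ≤ f(x) ≤ γ₂ for all x ∈ [0,1]. Define the group reward function R : [0,1]^k → ℝ by R(μ) = (Σ_{i} f(μ_i)·μ_i) / (Σ_{j} f(μ_j)). Then there exists a constant L₁ > 0 such that for all μ, μ' ∈ [0,1]^k, |R(μ) − R(μ')| ≤ L₁ · max_i |μ_i − μ'_i|. -/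
/-- Lipschitz continuity of the group reward function
`R(μ) = (Σ_i f(μ_i)·μ_i) / (Σ_j f(μ_j))` of the merit-fair policy, when the
merit function `f` is `L`-Lipschitz and bounded in `[γ₁, γ₂]` on `[0,1]`. -/
theorem group_reward_lipschitz
    (k : ℕ) (hk : 1 ≤ k) (L : ℝ) (hL : 0 < L)
    (γ₁ γ₂ : ℝ) (hγ₁ : 0 < γ₁) (hγ₁₂ : γ₁ ≤ γ₂)
    (f : ℝ → ℝ)
    (hf : ∀ x y : ℝ, |f x - f y| ≤ L * |x - y|)
    (hfb : ∀ x ∈ Set.Icc (0 : ℝ) 1, γ₁ ≤ f x ∧ f x ≤ γ₂) :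
    ∃ L₁ : ℝ, 0 < L₁ ∧
      ∀ μ μ' : Fin k → ℝ,
        (∀ i, μ i ∈ Set.Icc (0 : ℝ) 1) → (∀ i, μ' i ∈ Set.Icc (0 : ℝ) 1) →
        |(∑ i, f (μ i) * μ i) / (∑ j, f (μ j))
            - (∑ i, f (μ' i) * μ' i) / (∑ j, f (μ' j))|
          ≤ L₁ * ⨆ i, |μ i - μ' i| := by
  refine ⟨1 + L / γ₁, by positivity, fun μ μ' hμ hμ' => ?_⟩
  have : NeZero k := ⟨by omega⟩
  set D := ⨆ i, |μ i - μ' i|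
  have hD : ∀ i, |μ i - μ' i| ≤ D := fun i =>
    le_ciSup (f := fun i => |μ i - μ' i|) (Set.finite_range _).bddAbove i
  have hpos : ∀ ν : Fin k → ℝ, (∀ i, ν i ∈ Set.Icc (0 : ℝ) 1) → 0 < ∑ j, f (ν j) := fun ν hν =>
    Finset.sum_pos (fun j _ => hγ₁.trans_le (hfb _ (hν j)).1) Finset.univ_nonempty
  have hB := hpos μ hμ
  have hB' := hpos μ' hμ'
  have hf' : ∀ i, 0 ≤ f (μ' i) := fun i => hγ₁.le.trans (hfb _ (hμ' i)).1
  set r := (∑ i, f (μ' i) * μ' i) / (∑ j, f (μ' j))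
  have hr0 : 0 ≤ r :=
    div_nonneg (Finset.sum_nonneg fun i _ => mul_nonneg (hf' i) (hμ' i).1) hB'.le
  have hr1 : r ≤ 1 :=
    (div_le_one hB').2 (Finset.sum_le_sum fun i _ => mul_le_of_le_one_right (hf' i) (hμ' i).2)
  have hrB : ∑ i, f (μ' i) * μ' i = r * ∑ j, f (μ' j) := (div_mul_cancel₀ _ hB'.ne').symm
  -- The weighted deviations from `r` at `μ'` sum to zero, so they may be subtracted for free.
  have hsum : (∑ i, f (μ i) * μ i) / (∑ j, f (μ j)) - r
      = (∑ i, (f (μ i) * (μ i - μ' i) + (f (μ i) - f (μ' i)) * (μ' i - r))) / ∑ j, f (μ j) := by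
    rw [eq_div_iff hB.ne', sub_mul, div_mul_cancel₀ _ hB.ne']
    have hterm : ∀ i, f (μ i) * (μ i - μ' i) + (f (μ i) - f (μ' i)) * (μ' i - r)
        = f (μ i) * μ i - r * f (μ i) - (f (μ' i) * μ' i - r * f (μ' i)) := fun i => by ring
    simp only [hterm, Finset.sum_sub_distrib, ← Finset.mul_sum]
    rw [hrB]
    ring
  rw [hsum, abs_div, abs_of_pos hB, div_le_iff₀ hB, Finset.mul_sum]
  refine (Finset.abs_sum_le_sum_abs _ _).trans (Finset.sum_le_sum fun i _ => ?_)
  have hfi := (hfb _ (hμ i)).1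
  have hdev : |μ' i - r| ≤ 1 := abs_le.2 ⟨by linarith [(hμ' i).1], by linarith [(hμ' i).2]⟩
  have hD0 : 0 ≤ D := (abs_nonneg _).trans (hD i)
  have hLf : L ≤ L / γ₁ * f (μ i) := by
    rw [div_mul_eq_mul_div, le_div_iff₀ hγ₁]
    exact mul_le_mul_of_nonneg_left hfi hL.le
  calc |f (μ i) * (μ i - μ' i) + (f (μ i) - f (μ' i)) * (μ' i - r)|
      ≤ f (μ i) * |μ i - μ' i| + |f (μ i) - f (μ' i)| * |μ' i - r| := by
        refine (abs_add_le _ _).trans_eq ?_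
        rw [abs_mul, abs_mul, abs_of_pos (hγ₁.trans_le hfi)]
    _ ≤ f (μ i) * D + L * D * 1 := by
        have hfD := (hf (μ i) (μ' i)).trans (mul_le_mul_of_nonneg_left (hD i) hL.le)
        exact add_le_add (mul_le_mul_of_nonneg_left (hD i) (hγ₁.le.trans hfi))
          (mul_le_mul hfD hdev (abs_nonneg _) (by positivity))
    _ ≤ f (μ i) * D + L / γ₁ * f (μ i) * D := by
        rw [mul_one]
        gcongr
    _ = (1 + L / γ₁) * D * f (μ i) := by ring
end

section
/- Let k ≥ 1 and let u, v : Fin k → ℝ be nonnegative vectors with Σ_i u_i > 0 and Σ_i v_i > 0. Then Σ_i | u_i/(Σ_j u_j) − v_i/(Σ_j v_j) | ≤ 2 · (Σ_i |u_i − v_i|) / (Σ_j v_j). -/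
/-- Normalization-perturbation inequality: the ℓ¹ distance between the
probability distributions obtained by normalizing two nonnegative vectors is
bounded by twice the ℓ¹ distance of the vectors divided by the total mass of
one of them. -/
theorem normalized_l1_perturbation
    (k : ℕ) (hk : 1 ≤ k) (u v : Fin k → ℝ)
    (hu : ∀ i, 0 ≤ u i) (hv : ∀ i, 0 ≤ v i)
    (hsu : 0 < ∑ i, u i) (hsv : 0 < ∑ i, v i) :
    ∑ i, |u i / (∑ j, u j) - v i / (∑ j, v j)|
      ≤ 2 * (∑ i, |u i - v i|) / (∑ j, v j) := by
  have hdiff : |∑ j, v j - ∑ j, u j| ≤ ∑ i, |u i - v i| := by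
    rw [abs_sub_comm, ← Finset.sum_sub_distrib]
    exact Finset.abs_sum_le_sum_abs _ _
  generalize hU : ∑ j, u j = U at *
  generalize hV : ∑ j, v j = V at *
  have hterm : ∀ i, |u i / U - v i / V| ≤ |u i - v i| / V + u i * (|V - U| / (U * V)) := by
    intro i
    have hsplit : u i / U - v i / V = (u i - v i) / V + u i * ((V - U) / (U * V)) := by
      field_simp
      ring
    rw [hsplit]
    refine (abs_add_le _ _).trans_eq ?_
    rw [abs_div, abs_mul, abs_div, abs_of_pos hsv, abs_of_nonneg (hu i),
      abs_of_pos (mul_pos hsu hsv)]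
  calc ∑ i, |u i / U - v i / V|
      ≤ ∑ i, (|u i - v i| / V + u i * (|V - U| / (U * V))) :=
        Finset.sum_le_sum fun i _ => hterm i
    _ = (∑ i, |u i - v i| + |V - U|) / V := by
        rw [Finset.sum_add_distrib, ← Finset.sum_div, ← Finset.sum_mul, hU]
        field_simp
    _ ≤ 2 * (∑ i, |u i - v i|) / V := by
        gcongr
        linarith
end

section
/- Let k ≥ 1, L > 0, γ₁ > 0, and let f : ℝ → ℝ be L-Lipschitz with f(x) ≥ γ₁ for all x ∈ [0,1]. Define, for μ ∈ [0,1]^k, the merit-fair policy π(μ)_i := f(μ_i) / (Σ_j f(μ_j)). Then for all μ, μ' ∈ [0,1]^k, Σ_i |π(μ)_i − π(μ')_i| ≤ (2L/γ₁) · Σ_i |μ_i − μ'_i|. -/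
/-- Normalizing two vectors to total mass one is Lipschitz in `ℓ¹`, with constant `2 / ∑ j, a j`. -/
theorem sum_abs_div_sum_sub_div_sum_le {ι : Type*} [Fintype ι] (a b : ι → ℝ)
    (hb : ∀ i, 0 ≤ b i) (ha_sum : 0 < ∑ j, a j) (hb_sum : 0 < ∑ j, b j) :
    ∑ i, |a i / (∑ j, a j) - b i / (∑ j, b j)| ≤ 2 / (∑ j, a j) * ∑ i, |a i - b i| := by
  have hdiff : |(∑ j, b j) - ∑ j, a j| ≤ ∑ i, |a i - b i| := by
    rw [abs_sub_comm, ← Finset.sum_sub_distrib]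
    exact Finset.abs_sum_le_sum_abs _ _
  set A := ∑ j, a j
  set B := ∑ j, b j with hB
  have hterm (i : ι) : |a i / A - b i / B| ≤ |a i - b i| / A + b i / B * (|B - A| / A) := by
    have hsplit : a i / A - b i / B = (a i - b i) / A + b i / B * ((B - A) / A) := by
      field_simp
      ring
    rw [hsplit]
    refine (abs_add_le _ _).trans_eq ?_
    rw [abs_mul, abs_div, abs_div (B - A), abs_of_pos ha_sum,
      abs_of_nonneg (div_nonneg (hb i) hb_sum.le)]
  calc ∑ i, |a i / A - b i / B|
      ≤ ∑ i, (|a i - b i| / A + b i / B * (|B - A| / A)) := Finset.sum_le_sum fun i _ => hterm i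
    _ = (∑ i, |a i - b i|) / A + |B - A| / A := by
      rw [Finset.sum_add_distrib, ← Finset.sum_div, ← Finset.sum_mul, ← Finset.sum_div, ← hB,
        div_self hb_sum.ne', one_mul]
    _ ≤ (∑ i, |a i - b i|) / A + (∑ i, |a i - b i|) / A := by gcongr
    _ = 2 / A * ∑ i, |a i - b i| := by ring

/-- ℓ¹ stability of the merit-fair policy: if the merit function `f` is
`L`-Lipschitz and bounded below by `γ₁` on `[0,1]`, then the policies
`π(μ)_i = f(μ_i)/Σ_j f(μ_j)` for two reward vectors `μ, μ'` in `[0,1]^k`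
differ in ℓ¹ by at most `(2L/γ₁) · Σ_i |μ_i - μ'_i|`. -/
theorem merit_fair_policy_l1_stability
    (k : ℕ) (hk : 1 ≤ k) (L γ₁ : ℝ) (hL : 0 < L) (hγ₁ : 0 < γ₁)
    (f : ℝ → ℝ)
    (hf : ∀ x y : ℝ, |f x - f y| ≤ L * |x - y|)
    (hfb : ∀ x ∈ Set.Icc (0 : ℝ) 1, γ₁ ≤ f x)
    (μ μ' : Fin k → ℝ)
    (hμ : ∀ i, μ i ∈ Set.Icc (0 : ℝ) 1) (hμ' : ∀ i, μ' i ∈ Set.Icc (0 : ℝ) 1) :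
    ∑ i, |f (μ i) / (∑ j, f (μ j)) - f (μ' i) / (∑ j, f (μ' j))|
      ≤ (2 * L / γ₁) * ∑ i, |μ i - μ' i| := by
  have : Nonempty (Fin k) := ⟨⟨0, hk⟩⟩
  have hpos (x : Fin k → ℝ) (hx : ∀ i, x i ∈ Set.Icc (0 : ℝ) 1) (i : Fin k) : 0 < f (x i) :=
    hγ₁.trans_le (hfb _ (hx i))
  have hsum_pos (x : Fin k → ℝ) (hx : ∀ i, x i ∈ Set.Icc (0 : ℝ) 1) : 0 < ∑ j, f (x j) :=
    Finset.sum_pos (fun i _ => hpos x hx i) Finset.univ_nonempty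
  have hsum_ge : γ₁ ≤ ∑ j, f (μ j) :=
    (hfb _ (hμ ⟨0, hk⟩)).trans
      (Finset.single_le_sum (f := fun j => f (μ j)) (fun i _ => (hpos μ hμ i).le)
        (Finset.mem_univ _))
  calc ∑ i, |f (μ i) / (∑ j, f (μ j)) - f (μ' i) / (∑ j, f (μ' j))|
      ≤ 2 / (∑ j, f (μ j)) * ∑ i, |f (μ i) - f (μ' i)| :=
        sum_abs_div_sum_sub_div_sum_le _ _ (fun i => (hpos μ' hμ' i).le)
          (hsum_pos μ hμ) (hsum_pos μ' hμ')
    _ ≤ 2 / γ₁ * ∑ i, L * |μ i - μ' i| := by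
      gcongr
      exact hf _ _
    _ = (2 * L / γ₁) * ∑ i, |μ i - μ' i| := by
      rw [← Finset.mul_sum]
      ring
end

section
/- Let k ≥ 1 and let b : Fin k → ℝ satisfy 1/2 ≤ b_i ≤ 1 for all i. Then for every μ : Fin k → ℝ with 1/2 ≤ μ_i ≤ b_i for all i, one has (Σ_i μ_i²)/(Σ_j μ_j) ≤ (Σ_i b_i²)/(Σ_j b_j); i.e., the function μ ↦ Σ_i μ_i²/Σ_j μ_j on the box Π_i [1/2, b_i] is maximized at μ = b. -/
/-- With the identity merit function, the group reward
`R(μ) = (Σ_i μ_i²)/(Σ_j μ_j)` on the box `Π_i [1/2, b_i]` (with `b_i ∈ [1/2,1]`)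
is maximized at `μ = b`. -/
theorem identity_merit_reward_maximized_at_upper
    (k : ℕ) (hk : 1 ≤ k) (b : Fin k → ℝ)
    (hb : ∀ i, 1 / 2 ≤ b i ∧ b i ≤ 1)
    (μ : Fin k → ℝ) (hμ : ∀ i, 1 / 2 ≤ μ i ∧ μ i ≤ b i) :
    (∑ i, μ i ^ 2) / (∑ j, μ j) ≤ (∑ i, b i ^ 2) / (∑ j, b j) := by
  have : Nonempty (Fin k) := ⟨⟨0, hk⟩⟩
  have hμ_pos : 0 < ∑ j, μ j :=
    Finset.sum_pos (fun i _ => by linarith [hμ i]) Finset.univ_nonempty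
  have hb_pos : 0 < ∑ j, b j :=
    Finset.sum_pos (fun i _ => by linarith [hb i]) Finset.univ_nonempty
  set R := (∑ i, μ i ^ 2) / (∑ j, μ j) with hR
  have hR_le : R ≤ 1 := by
    rw [hR, div_le_one hμ_pos]
    exact Finset.sum_le_sum fun i _ => by nlinarith [hμ i, hb i]
  have hR_mul : R * ∑ j, μ j = ∑ i, μ i ^ 2 := div_mul_cancel₀ _ hμ_pos.ne'
  have hsum : ∑ i, (μ i ^ 2 - R * μ i) ≤ ∑ i, (b i ^ 2 - R * b i) := by
    refine Finset.sum_le_sum fun i _ => ?_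
    have hfactor : 0 ≤ (b i - μ i) * (b i + μ i - R) :=
      mul_nonneg (by linarith [hμ i]) (by linarith [hμ i, hb i])
    linarith
  simp only [Finset.sum_sub_distrib, ← Finset.mul_sum] at hsum
  rw [le_div_iff₀ hb_pos]
  linarith
end
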